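/- Strong converse for the two-sample test: let P ≠ Q be distributions on [d] with supp(P) ∩ supp(Q) ≠ ∅ and F* the unique minimizer of D(F‖P)+D(F‖Q). Suppose (Tₙ) is a sequence of acceptance regions (subsets of pairs of type distributions) such that -liminf (1/n)·log₂ Pr[(P̂ₙ, Q̂ₙ) ∈ Tₙ | Xⁿ∼P, Yⁿ∼Q] > D(F*‖P) + D(F*‖Q). Then Pr[(F̂ₙ, F̂'ₙ) ∉ Tₙ | Xⁿ, Yⁿ ∼ F*] → 1 as n → ∞. -/

import Mathlib

open MeasureTheory Filter Finset
open scoped ENNReal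

/-- `p` is a probability distribution on `Fin d`. -/
def IsProbDist {d : ℕ} (p : Fin d → ℝ) : Prop :=
  (∀ i, 0 ≤ p i) ∧ ∑ i, p i = 1

/-- Base-2 Kullback–Leibler divergence (real-valued version, meaningful when
`supp p ⊆ supp q`), with the convention `0 · log(0/q) = 0`. -/
noncomputable def klDivReal {d : ℕ} (p q : Fin d → ℝ) : ℝ :=
  ∑ i, if p i = 0 then 0 else p i * Real.logb 2 (p i / q i)

/-- Base-2 Kullback–Leibler divergence, `+∞` when `supp p ⊄ supp q`. -/
noncomputable def klDiv {d : ℕ} (p q : Fin d → ℝ) : EReal :=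
  if ∀ i, q i = 0 → p i = 0 then ((klDivReal p q : ℝ) : EReal) else ⊤

/-- Minimal nonzero entry of `p` (junk value `1` if there is none). -/
noncomputable def minPos {d : ℕ} (p : Fin d → ℝ) : ℝ :=
  if h : (Finset.univ.filter fun i => 0 < p i).Nonempty
  then (Finset.univ.filter fun i => 0 < p i).inf' h p else 1

/-- The continuity modulus `g(p, ε) = 2 log₂(1/p_min) ε + (2√2/ln 2) √ε`. -/
noncomputable def gCont {d : ℕ} (p : Fin d → ℝ) (ε : ℝ) : ℝ :=
  2 * Real.logb 2 (1 / minPos p) * ε + (2 * Real.sqrt 2 / Real.log 2) * Real.sqrt ε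

/-- The discrete measure on `Fin d` with mass `p i` at `i`. -/
noncomputable def discMeasure {d : ℕ} (p : Fin d → ℝ) : Measure (Fin d) :=
  Measure.count.withDensity fun i => ENNReal.ofReal (p i)

instance discMeasure.isFiniteMeasure {d : ℕ} (p : Fin d → ℝ) :
    IsFiniteMeasure (discMeasure p) := by
  constructor
  rw [discMeasure, withDensity_apply _ MeasurableSet.univ,
    MeasureTheory.setLIntegral_univ, MeasureTheory.lintegral_count, tsum_fintype]
  exact ENNReal.sum_lt_top.mpr fun i _ => ENNReal.ofReal_lt_top

/-- The law of `n` i.i.d. samples from `p`. -/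
noncomputable def iidMeasure {d : ℕ} (p : Fin d → ℝ) (n : ℕ) :
    Measure (Fin n → Fin d) :=
  Measure.pi fun _ => discMeasure p

/-- The empirical distribution of the sample `x`. -/
noncomputable def empDist {d n : ℕ} (x : Fin n → Fin d) : Fin d → ℝ :=
  fun i => ((Finset.univ.filter fun j => x j = i).card : ℝ) / n

/-- ℓ¹ distance between two vectors on `Fin d`. -/
noncomputable def l1Dist {d : ℕ} (p q : Fin d → ℝ) : ℝ :=
  ∑ i, |p i - q i|

lemma discMeasure_singleton {d : ℕ} (p : Fin d → ℝ) (i : Fin d) :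
    discMeasure p {i} = ENNReal.ofReal (p i) := by
  rw [discMeasure, withDensity_apply _ (measurableSet_singleton i), lintegral_singleton]
  simp

/-- The product of two i.i.d. laws evaluated on a set as a finite sum. -/
lemma iidMeasure_prod_apply {d n : ℕ} {p q : Fin d → ℝ} (hp : ∀ i, 0 ≤ p i) (hq : ∀ i, 0 ≤ q i)
    (s : Finset ((Fin n → Fin d) × (Fin n → Fin d))) :
    (iidMeasure p n).prod (iidMeasure q n) (s : Set ((Fin n → Fin d) × (Fin n → Fin d))) =
      ENNReal.ofReal (∑ z ∈ s, (∏ j, p (z.1 j)) * ∏ j, q (z.2 j)) := by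
  rw [← sum_measure_singleton, ENNReal.ofReal_sum_of_nonneg]
  · refine Finset.sum_congr rfl fun z _ => ?_
    rw [← Prod.mk.eta (p := z), ← Set.singleton_prod_singleton]
    have : IsFiniteMeasure (iidMeasure q n) := by unfold iidMeasure; infer_instance
    rw [Measure.prod_prod, iidMeasure, iidMeasure, Measure.pi_singleton, Measure.pi_singleton,
      ENNReal.ofReal_mul (Finset.prod_nonneg fun j _ => hp _),
      ENNReal.ofReal_prod_of_nonneg (fun j _ => hp _),
      ENNReal.ofReal_prod_of_nonneg (fun j _ => hq _)]
    simp only [discMeasure_singleton]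
  · exact fun z _ => mul_nonneg (Finset.prod_nonneg fun j _ => hp _)
      (Finset.prod_nonneg fun j _ => hq _)

lemma sum_prod_mul_prod {d : ℕ} (a b : Fin d → ℝ) (n : ℕ) :
    ∑ z : (Fin n → Fin d) × (Fin n → Fin d), (∏ j, a (z.1 j)) * ∏ j, b (z.2 j) =
      ((∑ i, a i) * ∑ i, b i) ^ n := by
  rw [mul_pow, Fintype.sum_pow, Fintype.sum_pow, Finset.sum_mul_sum, Fintype.sum_prod_type]

/-- Truncating the likelihood ratio `v / m` at level `K`. -/
lemma le_mul_add_mul_rpow {v m K s : ℝ} (hv : 0 ≤ v) (hm : 0 < m) (hK : 0 < K) (hs : 0 < s) :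
    v ≤ K * m + K ^ (-s) * (v * (v / m) ^ s) := by
  have hr : 0 ≤ v / m := div_nonneg hv hm.le
  rcases le_total (v / m) K with h | h
  · have h1 : v ≤ K * m := (div_le_iff₀ hm).1 h
    have : 0 ≤ K ^ (-s) * (v * (v / m) ^ s) := by positivity
    linarith
  · have h1 : 1 ≤ K ^ (-s) * (v / m) ^ s := by
      rw [Real.rpow_neg hK.le, inv_mul_eq_div, one_le_div (Real.rpow_pos_of_pos hK s)]
      exact Real.rpow_le_rpow hK.le h hs.le
    have h2 : v * 1 ≤ v * (K ^ (-s) * (v / m) ^ s) := mul_le_mul_of_nonneg_left h1 hv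
    have : 0 < K * m := mul_pos hK hm
    linarith

/-- Change of measure: the mass of a set under `F × F` in terms of its mass under `P × Q` and an
exponential moment of the likelihood ratio. -/
lemma sum_le_change_of_measure {d n : ℕ} {P Q F : Fin d → ℝ} (hP : ∀ i, 0 ≤ P i)
    (hQ : ∀ i, 0 ≤ Q i) (hF : ∀ i, 0 ≤ F i) (hFP : ∀ i, P i = 0 → F i = 0)
    (hFQ : ∀ i, Q i = 0 → F i = 0) {K s : ℝ} (hK : 0 < K) (hs : 0 < s)
    (S : Finset ((Fin n → Fin d) × (Fin n → Fin d))) :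
    ∑ z ∈ S, (∏ j, F (z.1 j)) * ∏ j, F (z.2 j) ≤
      K * ∑ z ∈ S, (∏ j, P (z.1 j)) * ∏ j, Q (z.2 j) +
        K ^ (-s) * ((∑ i, F i * (F i / P i) ^ s) * ∑ i, F i * (F i / Q i) ^ s) ^ n := by
  have ha : ∀ i, 0 ≤ F i * (F i / P i) ^ s := fun i =>
    mul_nonneg (hF i) (Real.rpow_nonneg (div_nonneg (hF i) (hP i)) s)
  have hb : ∀ i, 0 ≤ F i * (F i / Q i) ^ s := fun i =>
    mul_nonneg (hF i) (Real.rpow_nonneg (div_nonneg (hF i) (hQ i)) s)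
  have hab : ∀ z : (Fin n → Fin d) × (Fin n → Fin d), 0 ≤
      (∏ j, F (z.1 j) * (F (z.1 j) / P (z.1 j)) ^ s) *
        ∏ j, F (z.2 j) * (F (z.2 j) / Q (z.2 j)) ^ s := fun z =>
    mul_nonneg (Finset.prod_nonneg fun j _ => ha _) (Finset.prod_nonneg fun j _ => hb _)
  have hK' : 0 ≤ K ^ (-s) := Real.rpow_nonneg hK.le _
  rw [← sum_prod_mul_prod]
  refine le_trans ?_ (add_le_add_right (mul_le_mul_of_nonneg_left
    (Finset.sum_le_sum_of_subset_of_nonneg (Finset.subset_univ S) fun z _ _ => hab z) hK') _)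
  rw [Finset.mul_sum, Finset.mul_sum, ← Finset.sum_add_distrib]
  refine Finset.sum_le_sum fun z _ => ?_
  have hv : 0 ≤ (∏ j, F (z.1 j)) * ∏ j, F (z.2 j) :=
    mul_nonneg (Finset.prod_nonneg fun j _ => hF _) (Finset.prod_nonneg fun j _ => hF _)
  have hm : 0 ≤ (∏ j, P (z.1 j)) * ∏ j, Q (z.2 j) :=
    mul_nonneg (Finset.prod_nonneg fun j _ => hP _) (Finset.prod_nonneg fun j _ => hQ _)
  rcases hv.eq_or_lt with h0 | hpos
  · rw [← h0]
    exact add_nonneg (mul_nonneg hK.le hm) (mul_nonneg hK' (hab z))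
  have hx : ∏ j, F (z.1 j) ≠ 0 := left_ne_zero_of_mul hpos.ne'
  have hy : ∏ j, F (z.2 j) ≠ 0 := right_ne_zero_of_mul hpos.ne'
  have hx' : ∏ j, P (z.1 j) ≠ 0 := by
    rw [Finset.prod_ne_zero_iff] at hx ⊢
    exact fun j hj h => hx j hj (hFP _ h)
  have hy' : ∏ j, Q (z.2 j) ≠ 0 := by
    rw [Finset.prod_ne_zero_iff] at hy ⊢
    exact fun j hj h => hy j hj (hFQ _ h)
  have hm' := hm.lt_of_ne' (mul_ne_zero hx' hy')
  refine (le_mul_add_mul_rpow hv hm' hK hs).trans_eq ?_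
  congr 2
  rw [Finset.prod_mul_distrib, Finset.prod_mul_distrib,
    Real.finsetProd_rpow _ _ (fun j _ => div_nonneg (hF _) (hP _)),
    Real.finsetProd_rpow _ _ (fun j _ => div_nonneg (hF _) (hQ _)),
    Finset.prod_div_distrib, Finset.prod_div_distrib, mul_div_mul_comm, Real.mul_rpow]
  · ring
  · exact div_nonneg (Finset.prod_nonneg fun j _ => hF _) (Finset.prod_nonneg fun j _ => hP _)
  · exact div_nonneg (Finset.prod_nonneg fun j _ => hF _) (Finset.prod_nonneg fun j _ => hQ _)

/-- The exponential moment of the log-likelihood ratio has derivative `log 2 * D(F‖P)` at `0`. -/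
lemma hasDerivAt_sum_mul_rpow {d : ℕ} {P F : Fin d → ℝ} (hP : ∀ i, 0 ≤ P i) (hF : ∀ i, 0 ≤ F i)
    (hFP : ∀ i, P i = 0 → F i = 0) :
    HasDerivAt (fun s : ℝ => ∑ i, F i * (F i / P i) ^ s) (Real.log 2 * klDivReal F P) 0 := by
  rw [klDivReal, Finset.mul_sum]
  refine HasDerivAt.fun_sum fun i _ => ?_
  by_cases h : F i = 0
  · simpa [h] using hasDerivAt_const (0 : ℝ) (0 : ℝ)
  · have hpos : 0 < F i / P i :=
      div_pos ((hF i).lt_of_ne' h) ((hP i).lt_of_ne' fun h' => h (hFP i h'))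
    have h2 : Real.log 2 ≠ 0 := (Real.log_pos one_lt_two).ne'
    refine ((Real.hasStrictDerivAt_const_rpow hpos 0).hasDerivAt.const_mul (F i)).congr_deriv ?_
    rw [if_neg h, Real.logb, Real.rpow_zero]
    field_simp

/-- A Chernoff exponent: above the divergence the tilted moment drops below one. -/
lemma exists_rpow_mul_moment_lt_one {d : ℕ} {P Q F : Fin d → ℝ} (hP : ∀ i, 0 ≤ P i)
    (hQ : ∀ i, 0 ≤ Q i) (hF : IsProbDist F) (hFP : ∀ i, P i = 0 → F i = 0)
    (hFQ : ∀ i, Q i = 0 → F i = 0) {c : ℝ} (hc : klDivReal F P + klDivReal F Q < c) :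
    ∃ s : ℝ, 0 < s ∧
      (2 : ℝ) ^ (-c * s) * ((∑ i, F i * (F i / P i) ^ s) * ∑ i, F i * (F i / Q i) ^ s) < 1 := by
  set g : ℝ → ℝ := fun s =>
    (2 : ℝ) ^ (-c * s) * ((∑ i, F i * (F i / P i) ^ s) * ∑ i, F i * (F i / Q i) ^ s) with hg
  have hg0 : g 0 = 1 := by simp [hg, hF.2]
  have h2 : 0 < Real.log 2 := Real.log_pos one_lt_two
  have hpow : HasDerivAt (fun s : ℝ => (2 : ℝ) ^ (-c * s)) (Real.log 2 * -c) 0 := by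
    simpa using ((hasDerivAt_id (0 : ℝ)).const_mul (-c)).const_rpow (a := 2) two_pos
  have hder := hpow.mul ((hasDerivAt_sum_mul_rpow hP hF.1 hFP).mul
    (hasDerivAt_sum_mul_rpow hQ hF.1 hFQ))
  have hder' : HasDerivAt g (Real.log 2 * (klDivReal F P + klDivReal F Q - c)) 0 := by
    refine hder.congr_deriv ?_
    simp [hF.2]
    ring
  have hneg : Real.log 2 * (klDivReal F P + klDivReal F Q - c) < 0 :=
    mul_neg_of_pos_of_neg h2 (by linarith)
  have hev := (hasDerivAt_iff_tendsto_slope.1 hder').eventually (gt_mem_nhds hneg)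
  have hev' := hev.filter_mono
    (nhdsWithin_mono 0 fun x (hx : x ∈ Set.Ioi 0) => (Set.mem_Ioi.1 hx).ne')
  obtain ⟨s, hs, hs0⟩ := (hev'.and self_mem_nhdsWithin).exists
  have hs0 : 0 < s := hs0
  refine ⟨s, hs0, ?_⟩
  have : g s - g 0 < 0 := by
    have hs' : (g s - g 0) / (s - 0) < 0 := by simpa [slope_def_field] using hs
    rw [sub_zero] at hs'
    by_contra! hcon
    exact absurd hs' (not_lt.2 (div_nonneg hcon hs0.le))
  rw [hg0] at this
  exact sub_neg.1 this

/-- An exponent bound on an extended nonnegative real, rewritten as an upper bound. -/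
lemma lt_two_rpow_of_lt_neg_log {n : ℕ} (hn : 0 < n) {b r : ℝ} (hr : 0 ≤ r)
    (h : (b : EReal) < (((-1 : ℝ) / (n * Real.log 2) : ℝ) : EReal) *
      ENNReal.log (ENNReal.ofReal r)) : r < (2 : ℝ) ^ (-(b * n)) := by
  rcases hr.eq_or_lt with rfl | hpos
  · positivity
  rw [ENNReal.log_ofReal_of_pos hpos, ← EReal.coe_mul, EReal.coe_lt_coe_iff] at h
  have h2 : 0 < Real.log 2 := Real.log_pos one_lt_two
  have hn' : (0 : ℝ) < n := Nat.cast_pos.2 hn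
  rw [div_mul_eq_mul_div, lt_div_iff₀ (by positivity)] at h
  rw [Real.rpow_def_of_pos two_pos, ← Real.log_lt_iff_lt_exp hpos]
  linarith

lemma klDiv_ne_bot {d : ℕ} (p q : Fin d → ℝ) : klDiv p q ≠ ⊥ := by
  unfold klDiv
  split_ifs <;> simp

lemma klDiv_ne_top_iff {d : ℕ} {p q : Fin d → ℝ} :
    klDiv p q ≠ ⊤ ↔ ∀ i, q i = 0 → p i = 0 := by
  unfold klDiv
  split_ifs with h <;> simpa using h


/-- strong converse for the two-sample test.  If the acceptance
regions `Tₙ` have type II error exponent strictly larger than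
`D(F*‖P) + D(F*‖Q)` (for the unique minimizer `F*`), then under samples drawn
from `F*` the probability of falling outside `Tₙ` tends to one. -/
theorem two_sample_strong_converse {d : ℕ} (P Q Fstar : Fin d → ℝ)
    (hP : IsProbDist P) (hQ : IsProbDist Q) (hne : P ≠ Q)
    (hsupp : ∃ i, P i ≠ 0 ∧ Q i ≠ 0)
    (hFstar : IsProbDist Fstar)
    (hmin : ∀ F : Fin d → ℝ, IsProbDist F →
      klDiv Fstar P + klDiv Fstar Q ≤ klDiv F P + klDiv F Q)
    (T : ℕ → Set ((Fin d → ℝ) × (Fin d → ℝ)))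
    (hexp : klDiv Fstar P + klDiv Fstar Q <
      Filter.atTop.liminf (fun n : ℕ =>
        (((-1 : ℝ) / (n * Real.log 2) : ℝ) : EReal) *
          ENNReal.log ((iidMeasure P n).prod (iidMeasure Q n)
            {xy | (empDist xy.1, empDist xy.2) ∈ T n}))) :
    Filter.Tendsto (fun n : ℕ =>
        (iidMeasure Fstar n).prod (iidMeasure Fstar n)
          {xy | (empDist xy.1, empDist xy.2) ∉ T n})
      Filter.atTop (nhds 1) := by
  have hfin := (hexp.trans_le le_top).ne
  have hFP : ∀ i, P i = 0 → Fstar i = 0 := klDiv_ne_top_iff.1 fun h =>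
    hfin (by rw [h, EReal.top_add_of_ne_bot (klDiv_ne_bot _ _)])
  have hFQ : ∀ i, Q i = 0 → Fstar i = 0 := klDiv_ne_top_iff.1 fun h =>
    hfin (by rw [h, EReal.add_top_of_ne_bot (klDiv_ne_bot _ _)])
  rw [klDiv, klDiv, if_pos hFP, if_pos hFQ, ← EReal.coe_add] at hexp
  obtain ⟨b, hDb, hb⟩ := EReal.lt_iff_exists_real_btwn.1 hexp
  obtain ⟨c, hDc, hcb⟩ := exists_between (EReal.coe_lt_coe_iff.1 hDb)
  obtain ⟨s, hs, hlt⟩ := exists_rpow_mul_moment_lt_one hP.1 hQ.1 hFstar hFP hFQ hDc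
  set M := (∑ i, Fstar i * (Fstar i / P i) ^ s) * ∑ i, Fstar i * (Fstar i / Q i) ^ s
  have hM0 : 0 ≤ M := mul_nonneg
    (Finset.sum_nonneg fun i _ => mul_nonneg (hFstar.1 i)
      (Real.rpow_nonneg (div_nonneg (hFstar.1 i) (hP.1 i)) s))
    (Finset.sum_nonneg fun i _ => mul_nonneg (hFstar.1 i)
      (Real.rpow_nonneg (div_nonneg (hFstar.1 i) (hQ.1 i)) s))
  classical
  let S : (n : ℕ) → Finset ((Fin n → Fin d) × (Fin n → Fin d)) := fun n =>
    Finset.univ.filter fun xy => (empDist xy.1, empDist xy.2) ∈ T n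
  have hS : ∀ n : ℕ, {xy : (Fin n → Fin d) × (Fin n → Fin d) |
      (empDist xy.1, empDist xy.2) ∈ T n} = S n := fun n => by ext; simp [S]
  have hSc : ∀ n : ℕ, {xy : (Fin n → Fin d) × (Fin n → Fin d) |
      (empDist xy.1, empDist xy.2) ∉ T n} = ((S n)ᶜ : Finset _) := fun n => by ext; simp [S]
  set v : ℕ → ℝ := fun n =>
    ∑ z ∈ S n, (∏ j, Fstar (z.1 j)) * ∏ j, Fstar (z.2 j) with hv
  have hv0 : ∀ n, 0 ≤ v n := fun n => Finset.sum_nonneg fun z _ =>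
    mul_nonneg (Finset.prod_nonneg fun j _ => hFstar.1 _)
      (Finset.prod_nonneg fun j _ => hFstar.1 _)
  have hbound : ∀ᶠ n : ℕ in atTop,
      v n ≤ ((2 : ℝ) ^ (c - b)) ^ n + ((2 : ℝ) ^ (-c * s) * M) ^ n := by
    filter_upwards [Filter.eventually_lt_of_lt_liminf hb, eventually_gt_atTop 0] with n hn hn0
    rw [hS, iidMeasure_prod_apply hP.1 hQ.1] at hn
    have hm := lt_two_rpow_of_lt_neg_log hn0 (Finset.sum_nonneg fun z _ =>
      mul_nonneg (Finset.prod_nonneg fun j _ => hP.1 _)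
        (Finset.prod_nonneg fun j _ => hQ.1 _)) hn
    have hK : (0 : ℝ) < 2 ^ (c * n) := by positivity
    refine (sum_le_change_of_measure hP.1 hQ.1 hFstar.1 hFP hFQ hK hs (S n)).trans ?_
    refine add_le_add ((mul_le_mul_of_nonneg_left hm.le hK.le).trans_eq ?_) (le_of_eq ?_)
    · rw [← Real.rpow_add two_pos, ← Real.rpow_natCast, ← Real.rpow_mul two_pos.le]
      congr 1
      ring
    · rw [mul_pow _ M, ← Real.rpow_natCast (2 ^ (-c * s)), ← Real.rpow_mul two_pos.le,
        ← Real.rpow_mul two_pos.le]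
      congr 2
      ring
  have hlim : Tendsto v atTop (nhds 0) := by
    refine squeeze_zero' (Eventually.of_forall hv0) hbound ?_
    rw [← add_zero (0 : ℝ)]
    exact (tendsto_pow_atTop_nhds_zero_of_lt_one (by positivity)
      (Real.rpow_lt_one_of_one_lt_of_neg one_lt_two (by linarith))).add
      (tendsto_pow_atTop_nhds_zero_of_lt_one (by positivity) hlt)
  have hcompl : ∀ n : ℕ, (iidMeasure Fstar n).prod (iidMeasure Fstar n)
      {xy | (empDist xy.1, empDist xy.2) ∉ T n} = ENNReal.ofReal (1 - v n) := fun n => by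
    rw [hSc, iidMeasure_prod_apply hFstar.1 hFstar.1]
    have h1 := Finset.sum_add_sum_compl (S n)
      fun z => (∏ j, Fstar (z.1 j)) * ∏ j, Fstar (z.2 j)
    rw [sum_prod_mul_prod, hFstar.2, mul_one, one_pow] at h1
    rw [← h1, hv, add_sub_cancel_left]
  simp only [hcompl]
  simpa using ENNReal.tendsto_ofReal (hlim.const_sub 1)
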